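/- Let d = (d(1),…,d(n)) be a degree sequence with d(i) ≥ 1 for all i and ∑_{i=1}^n d(i) ≥ 2n−1. Then the random sequence (s_1,…,s_{n−1}) of non-root half-edges chosen during Pitman's additive coalescent is uniformly distributed over the set of all sequences of n−1 distinct elements of ⋃_{i=1}^n {i1,…,i(d(i)−1)}. Consequently, the unordered set {s_1,…,s_{n−1}} is a uniformly random (n−1)-element subset of ⋃_{i=1}^n {i1,…,i(d(i)−1)}. -/

import Mathlib

open Classical Filter

namespace TWG

/-- Half-edges for the degree sequence `d`: vertex `i` carries `d i` half-edges,
encoded as `⟨i, j⟩` for `j : Fin (d i)`; `⟨i, d i - 1⟩` is the root half-edge of `i`. -/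
abbrev HE {n : ℕ} (d : Fin n → ℕ) := (i : Fin n) × Fin (d i)

def IsRootHE {n : ℕ} (d : Fin n → ℕ) (h : HE d) : Prop := (h.2 : ℕ) = d h.1 - 1

def IsNonRootHE {n : ℕ} (d : Fin n → ℕ) (h : HE d) : Prop := (h.2 : ℕ) < d h.1 - 1

/-- A candidate execution path: at each of the `n-1` steps, a pair
(root half-edge `r_k`, non-root half-edge `s_k`) is chosen. -/
abbrev Path {n : ℕ} (d : Fin n → ℕ) := Fin (n - 1) → HE d × HE d

/-- Vertices `a` and `b` lie in the same tree of the forest present at the start of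
step `k`, i.e. they are joined by the edges created at steps `j < k`. -/
def SameTree {n : ℕ} {d : Fin n → ℕ} (E : Path d) (k : Fin (n - 1)) (a b : Fin n) : Prop :=
  Relation.ReflTransGen
    (fun x y => ∃ j, j < k ∧
      (((E j).1.1 = x ∧ (E j).2.1 = y) ∨ ((E j).1.1 = y ∧ (E j).2.1 = x))) a b

/-- `E` is a valid execution path of Pitman's additive coalescent for `d`:
at each step, `r_k` is an as-yet-unpaired root half-edge, `s_k` is an
as-yet-unpaired non-root half-edge, and they lie in different trees of the
current forest. -/
def IsExecPath {n : ℕ} (d : Fin n → ℕ) (E : Path d) : Prop :=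
  ∀ k : Fin (n - 1),
    IsRootHE d (E k).1 ∧ IsNonRootHE d (E k).2 ∧
    (∀ j, j < k → (E j).1 ≠ (E k).1) ∧
    (∀ j, j < k → (E j).2 ≠ (E k).2) ∧
    ¬ SameTree E k (E k).1.1 (E k).2.1

/-- The number of children of vertex `i` in the tree `T(d)` built by `E`. -/
noncomputable def cc {n : ℕ} {d : Fin n → ℕ} (E : Path d) (i : Fin n) : ℕ :=
  Nat.card {k : Fin (n - 1) // (E k).2.1 = i}

/-- `v` is a non-root vertex of the tree built by `E`. -/
def IsNonRootV {n : ℕ} {d : Fin n → ℕ} (E : Path d) (v : Fin n) : Prop :=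
  ∃ k, (E k).1.1 = v

/-- The parent of `v` in the tree built by `E` (equal to `v` itself for the root). -/
noncomputable def parentOf {n : ℕ} {d : Fin n → ℕ} (E : Path d) (v : Fin n) : Fin n :=
  if h : ∃ k, (E k).1.1 = v then (E h.choose).2.1 else v

/-- The tree built by `E` is the rooted tree with root `root` and parent map `par`. -/
def TreeEq {n : ℕ} {d : Fin n → ℕ} (E : Path d) (root : Fin n) (par : Fin n → Fin n) : Prop :=
  (∀ k, par (E k).1.1 = (E k).2.1) ∧ ∀ v, v ≠ root → ∃ k, (E k).1.1 = v

/-- `(root, par)` encodes a rooted tree on `Fin n`: the root is a fixed point of the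
parent map and every vertex reaches the root by iterating the parent map. -/
def IsRootedTree {n : ℕ} (root : Fin n) (par : Fin n → Fin n) : Prop :=
  par root = root ∧ ∀ v, ∃ m, par^[m] v = root

/-- The number of children of `i` in the rooted tree `(root, par)`. -/
noncomputable def childCount {n : ℕ} (root : Fin n) (par : Fin n → Fin n) (i : Fin n) : ℕ :=
  Nat.card {v : Fin n // v ≠ root ∧ par v = i}

/-- `h` is one of the half-edges paired during the execution path `E`. -/
def UsedIn {n : ℕ} {d : Fin n → ℕ} (E : Path d) (h : HE d) : Prop :=
  (∃ k, (E k).1 = h) ∨ (∃ k, (E k).2 = h)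

/-- `M` pairs up, as a fixed-point-free involution, exactly the half-edges left
unpaired by `E` (its fixed points are exactly the half-edges used by `E`). -/
def IsCompletion {n : ℕ} {d : Fin n → ℕ} (E : Path d) (M : HE d → HE d) : Prop :=
  Function.Involutive M ∧ ∀ h, (M h = h ↔ UsedIn E h)

/-- The number of half-edges at `u`, unpaired by `E`, which `M` matches to a
half-edge at `v`.  For `u ≠ v` this is the number of `M`-edges joining `u` and `v`;
for `u = v` it is twice the number of `M`-loops at `u`. -/
noncomputable def matchCount {n : ℕ} {d : Fin n → ℕ} (E : Path d) (M : HE d → HE d)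
    (u v : Fin n) : ℕ :=
  Nat.card {h : HE d // ¬ UsedIn E h ∧ h.1 = u ∧ (M h).1 = v}

/-- `P(Bin(m, ρ) = a)`. -/
noncomputable def binomP (ρ : ℝ) (m a : ℕ) : ℝ :=
  (m.choose a : ℝ) * ρ ^ a * (1 - ρ) ^ (m - a)


/-- The (unordered) set of non-root half-edges chosen by `E` is `H`. -/
def SSetEq {n : ℕ} {d : Fin n → ℕ} (E : Path d) (H : Finset (HE d)) : Prop :=
  ∀ h, h ∈ H ↔ ∃ k, (E k).2 = h

/-- Connectivity by the edges `(r j, s j)`, `j < m`. -/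
def RR {V : Type*} (s : ℕ → V) (m : ℕ) (r : Fin m → V) (a b : V) : Prop :=
  Relation.ReflTransGen
    (fun x y => ∃ j : Fin m, ((r j = x ∧ s j = y) ∨ (r j = y ∧ s j = x))) a b

def Valid {V : Type*} (s : ℕ → V) : (m : ℕ) → (Fin m → V) → Prop
  | 0, _ => True
  | m + 1, r => Valid s m (Fin.init r) ∧ (∀ j : Fin m, Fin.init r j ≠ r (Fin.last m)) ∧
      ¬ RR s m (Fin.init r) (r (Fin.last m)) (s m)

theorem RR.symm {V : Type*} {s : ℕ → V} {m : ℕ} {r : Fin m → V} {a b : V}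
    (h : RR s m r a b) : RR s m r b a := by
  unfold RR at *
  induction h with
  | refl => exact .refl
  | tail _ h2 ih =>
    refine .head ?_ ih
    obtain ⟨j, hj⟩ := h2
    exact ⟨j, hj.symm⟩

theorem RR.mono {V : Type*} {s : ℕ → V} {m : ℕ} {r : Fin (m + 1) → V} {a b : V}
    (h : RR s m (Fin.init r) a b) : RR s (m + 1) r a b := by
  refine Relation.ReflTransGen.mono ?_ _ _ h
  rintro x y ⟨j, hj⟩
  exact ⟨j.castSucc, hj⟩

theorem exists_root {V : Type*} (s : ℕ → V) : ∀ (m : ℕ) (r : Fin m → V), Valid s m r →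
    ∃ ρ : V → V, (∀ u v, RR s m r u v ↔ ρ u = ρ v) ∧ (∀ v j, r j ≠ ρ v) ∧
      (∀ u, (∀ j, r j ≠ u) → ρ u = u) := by
  intro m
  induction m with
  | zero =>
    intro r _
    refine ⟨id, ?_, fun v j => j.elim0, fun _ _ => rfl⟩
    intro u v
    constructor
    · intro h
      unfold RR at h
      induction h with
      | refl => rfl
      | tail _ h2 ih => exact h2.choose.elim0
    · rintro h
      cases h
      exact .refl
  | succ m ih =>
    intro r hr
    obtain ⟨h1, h2, h3⟩ := hr
    obtain ⟨ρ, p1, p2, p3⟩ := ih _ h1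
    have hl : ρ (r (Fin.last m)) = r (Fin.last m) := p3 _ h2
    rw [p1, hl] at h3
    have hedge : RR s (m + 1) r (r (Fin.last m)) (s m) :=
      .single ⟨Fin.last m, Or.inl ⟨rfl, rfl⟩⟩
    have hto : ∀ v, RR s (m + 1) r v (ρ v) := by
      intro v
      exact ((p1 v (ρ v)).2 (p3 _ (fun j => p2 v j)).symm).mono
    have key : ∀ v, RR s (m + 1) r v
        (if ρ v = r (Fin.last m) then ρ (s m) else ρ v) := by
      intro v
      split_ifs with h
      · have := hto v
        rw [h] at this
        exact (this.trans hedge).trans (hto _)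
      · exact hto v
    refine ⟨fun v => if ρ v = r (Fin.last m) then ρ (s m) else ρ v, ?_, ?_, ?_⟩
    · intro u v
      constructor
      · intro h
        unfold RR at h
        induction h with
        | refl => rfl
        | tail _ h2 ih =>
          rw [ih]
          obtain ⟨j, hj⟩ := h2
          revert hj
          refine Fin.lastCases ?_ (fun j => ?_) j
          · rintro (⟨rfl, rfl⟩ | ⟨rfl, rfl⟩)
            · simp [hl, Ne.symm h3]
            · simp [hl, Ne.symm h3]
          · intro hj
            have := (p1 _ _).1 (Relation.ReflTransGen.single ⟨j, hj⟩)
            simp only [this]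
      · intro h
        have h1 := key u
        have h2 := (key v).symm
        simp only at h
        rw [h] at h1
        exact h1.trans h2
    · intro v j
      refine Fin.lastCases ?_ (fun j => ?_) j
      · simp only
        split_ifs with h
        · exact h3
        · exact Ne.symm h
      · simp only
        split_ifs with h
        · exact p2 _ j
        · exact p2 _ j
    · intro u hu
      have : ρ u = u := p3 u (fun j => hu j.castSucc)
      simp only [this]
      rw [if_neg (Ne.symm (hu _))]

theorem Valid.inj {V : Type*} (s : ℕ → V) : ∀ (m : ℕ) (r : Fin m → V), Valid s m r →
    Function.Injective r := by
  intro m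
  induction m with
  | zero => intro r _ a; exact a.elim0
  | succ m ih =>
    intro r ⟨h1, h2, _⟩
    have h := ih _ h1
    intro a b
    refine Fin.lastCases ?_ (fun a => ?_) a <;> refine Fin.lastCases ?_ (fun b => ?_) b
    · intro _; rfl
    · intro hh; exact absurd hh.symm (h2 b)
    · intro hh; exact absurd hh (h2 a)
    · intro hh; rw [h hh]

theorem card_ext {V : Type*} [Fintype V] (s : ℕ → V) (m : ℕ) (r : Fin m → V)
    (hr : Valid s m r) :
    Nat.card {v : V // (∀ j : Fin m, r j ≠ v) ∧ ¬ RR s m r v (s m)}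
      = Fintype.card V - 1 - m := by
  obtain ⟨ρ, p1, p2, p3⟩ := exists_root s m r hr
  have hinj := hr.inj
  have h : (Finset.univ.filter
      fun v : V => (∀ j : Fin m, r j ≠ v) ∧ ¬ RR s m r v (s m)) =
      (Finset.univ \ insert (ρ (s m)) (Finset.univ.image r)) := by
    ext v
    simp only [Finset.mem_filter, Finset.mem_univ, true_and, Finset.mem_sdiff,
      Finset.mem_insert, Finset.mem_image, not_or, not_exists]
    rw [p1]
    constructor
    · rintro ⟨a, b⟩
      rw [p3 v a] at b
      exact ⟨b, a⟩
    · rintro ⟨b, a⟩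
      refine ⟨a, ?_⟩
      rw [p3 v a]
      exact b
  rw [Nat.card_eq_fintype_card, Fintype.card_subtype, h, Finset.card_sdiff_of_subset
    (Finset.subset_univ _), Finset.card_insert_of_notMem, Finset.card_image_of_injective _ hinj]
  · simp only [Finset.card_univ, Fintype.card_fin]
    omega
  · simp only [Finset.mem_image, Finset.mem_univ, true_and, not_exists]
    exact p2 _

theorem card_valid {V : Type*} [Fintype V] (s : ℕ → V) (m : ℕ) :
    Nat.card {r : Fin m → V // Valid s m r} = (Fintype.card V - 1).descFactorial m := by
  induction m with
  | zero =>
    simp only [Valid, Nat.descFactorial_zero]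
    rw [Nat.card_eq_one_iff_unique]
    exact ⟨inferInstance, ⟨⟨Fin.elim0, trivial⟩⟩⟩
  | succ m ih =>
    have e : {r : Fin (m + 1) → V // Valid s (m + 1) r} ≃
        (Σ r : {r : Fin m → V // Valid s m r},
          {v : V // (∀ j : Fin m, r.1 j ≠ v) ∧ ¬ RR s m r.1 v (s m)}) :=
      { toFun := fun r => ⟨⟨Fin.init r.1, r.2.1⟩, ⟨r.1 (Fin.last m), r.2.2⟩⟩
        invFun := fun p => ⟨Fin.snoc (α := fun _ => V) p.1.1 p.2.1, by
          refine ⟨?_, ?_⟩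
          · rw [Fin.init_snoc]; exact p.1.2
          · rw [Fin.init_snoc, Fin.snoc_last]; exact p.2.2⟩
        left_inv := by
          rintro ⟨r, hr⟩
          simp
        right_inv := by
          rintro ⟨⟨r, hr⟩, ⟨v, hv⟩⟩
          rw [Sigma.mk.injEq]
          have h1 : Fin.init (Fin.snoc (α := fun _ => V) r v) = r := Fin.init_snoc _ _
          refine ⟨Subtype.ext h1, ?_⟩
          simp only [Fin.snoc_last]
          congr! }
    rw [Nat.card_congr e, Nat.card_sigma]
    rw [Finset.sum_congr rfl (fun r _ => card_ext s m r.1 r.2)]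
    rw [Finset.sum_const, Finset.card_univ, ← Nat.card_eq_fintype_card, ih, smul_eq_mul,
      Nat.descFactorial_succ, mul_comm]

theorem valid_iff {V : Type*} (s : ℕ → V) : ∀ (m : ℕ) (r : Fin m → V), Valid s m r ↔
    ∀ k : Fin m, (∀ j, j < k → r j ≠ r k) ∧
      ¬ Relation.ReflTransGen (fun x y => ∃ j : Fin m, j < k ∧
        ((r j = x ∧ s j = y) ∨ (r j = y ∧ s j = x))) (r k) (s k) := by
  intro m
  induction m with
  | zero => intro r; simp [Valid]
  | succ m ih =>
    intro r
    rw [Fin.forall_fin_succ']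
    simp only [Valid]
    rw [ih]
    have hc : ∀ (P : Fin (m + 1) → Prop) (k : Fin m),
        (∃ j : Fin (m + 1), j < k.castSucc ∧ P j) ↔ ∃ j : Fin m, j < k ∧ P j.castSucc := by
      intro P k
      constructor
      · rintro ⟨j, hj, hP⟩
        exact ⟨⟨j, lt_trans hj k.2⟩, hj, hP⟩
      · rintro ⟨j, hj, hP⟩
        exact ⟨j.castSucc, hj, hP⟩
    have hl : ∀ (P : Fin (m + 1) → Prop),
        (∃ j : Fin (m + 1), j < Fin.last m ∧ P j) ↔ ∃ j : Fin m, P j.castSucc := by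
      intro P
      constructor
      · rintro ⟨j, hj, hP⟩
        exact ⟨⟨j, hj⟩, hP⟩
      · rintro ⟨j, hP⟩
        exact ⟨j.castSucc, Fin.castSucc_lt_last j, hP⟩
    refine and_congr (forall_congr' fun k => ?_) ?_
    · simp only [hc]
      refine and_congr ?_ Iff.rfl
      constructor
      · intro h j hj
        exact h ⟨j, lt_trans hj k.2⟩ hj
      · intro h j hj
        exact h j.castSucc hj
    · simp only [hl]
      refine and_congr ?_ Iff.rfl
      constructor
      · intro h j hj
        exact h ⟨j, hj⟩
      · intro h j
        exact h j.castSucc (Fin.castSucc_lt_last j)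

theorem card_seq (n : ℕ) (hn : 1 ≤ n) (d : Fin n → ℕ) (hd : ∀ i, 1 ≤ d i)
    (σ : Fin (n - 1) → HE d) (hσ : Function.Injective σ) (hσ2 : ∀ k, IsNonRootHE d (σ k)) :
    Nat.card {E : Path d // IsExecPath d E ∧ ∀ k, (E k).2 = σ k} = (n - 1).factorial := by
  set s : ℕ → Fin n := fun j => if h : j < n - 1 then (σ ⟨j, h⟩).1 else ⟨0, hn⟩ with hs
  have hsj : ∀ j : Fin (n - 1), s j = (σ j).1 := by
    intro j
    simp [hs]
  have e : {E : Path d // IsExecPath d E ∧ ∀ k, (E k).2 = σ k} ≃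
      {r : Fin (n - 1) → Fin n // Valid s (n - 1) r} :=
    { toFun := fun E => ⟨fun k => (E.1 k).1.1, by
        obtain ⟨E, hE, hE2⟩ := E
        rw [valid_iff]
        intro k
        obtain ⟨a1, a2, a3, a4, a5⟩ := hE k
        refine ⟨?_, ?_⟩
        · intro j hj he
          apply a3 j hj
          have b1 := (hE j).1
          unfold IsRootHE at a1 b1
          simp only at he
          refine Sigma.ext he ?_
          rw [Fin.heq_ext_iff (by rw [he]), a1, b1, he]
        · intro h
          apply a5
          unfold SameTree
          simp only [hE2, ← hsj]
          exact h⟩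
      invFun := fun r => ⟨fun k => (⟨r.1 k, ⟨d (r.1 k) - 1, by have := hd (r.1 k); omega⟩⟩, σ k), by
        obtain ⟨r, hr⟩ := r
        rw [valid_iff] at hr
        refine ⟨fun k => ⟨rfl, hσ2 k, ?_, ?_, ?_⟩, fun k => rfl⟩
        · intro j hj he
          exact (hr k).1 j hj (congrArg (fun x => x.1) he)
        · intro j hj he
          exact absurd (hσ he) hj.ne
        · intro h
          apply (hr k).2
          simp only [hsj]
          exact h⟩
      left_inv := by
        rintro ⟨E, hE, hE2⟩
        apply Subtype.ext
        funext k
        refine Prod.ext ?_ (hE2 k).symm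
        have b1 := (hE k).1
        unfold IsRootHE at b1
        refine Sigma.ext rfl (heq_of_eq (Fin.ext b1.symm))
      right_inv := by
        rintro ⟨r, hr⟩
        rfl }
  rw [Nat.card_congr e, card_valid, Fintype.card_fin, Nat.descFactorial_self]

theorem exec_inj {n : ℕ} {d : Fin n → ℕ} {E : Path d} (hE : IsExecPath d E) :
    Function.Injective (fun k => (E k).2) := by
  intro a b h
  rcases lt_trichotomy a b with h1 | h1 | h1
  · exact absurd h ((hE b).2.2.2.1 a h1)
  · exact h1
  · exact absurd h.symm ((hE a).2.2.2.1 b h1)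

theorem card_in (n : ℕ) (hn : 1 ≤ n) (d : Fin n → ℕ) (hd : ∀ i, 1 ≤ d i)
    (H : Finset (HE d)) (hH : ∀ h ∈ H, IsNonRootHE d h) :
    Nat.card {E : Path d // IsExecPath d E ∧ ∀ k, (E k).2 ∈ H} =
      H.card.descFactorial (n - 1) * (n - 1).factorial := by
  have e : {E : Path d // IsExecPath d E ∧ ∀ k, (E k).2 ∈ H} ≃
      (Σ f : Fin (n - 1) ↪ H, {E : Path d // IsExecPath d E ∧ ∀ k, (E k).2 = (f k : HE d)}) :=
    { toFun := fun E => ⟨⟨fun k => ⟨(E.1 k).2, E.2.2 k⟩, fun a b h =>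
        exec_inj E.2.1 (congrArg Subtype.val h)⟩, ⟨E.1, E.2.1, fun k => rfl⟩⟩
      invFun := fun p => ⟨p.2.1, p.2.2.1, fun k => by rw [p.2.2.2 k]; exact (p.1 k).2⟩
      left_inv := fun E => rfl
      right_inv := by
        rintro ⟨f, E, hE, hE2⟩
        have hP : ∀ k, (E k).2 ∈ H := fun k => by rw [hE2 k]; exact (f k).2
        have hf : (⟨fun k => ⟨(E k).2, hP k⟩, fun a b h =>
          exec_inj hE (congrArg Subtype.val h)⟩ : Fin (n - 1) ↪ H) = f := by
          ext1 k
          exact Subtype.ext (hE2 k)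
        subst hf
        rfl }
  rw [Nat.card_congr e, Nat.card_sigma, Finset.sum_congr rfl (fun f _ =>
    card_seq n hn d hd (fun k => (f k : HE d)) (Subtype.val_injective.comp f.injective)
      (fun k => hH _ (f k).2)), Finset.sum_const, Finset.card_univ, Fintype.card_embedding_eq]
  simp

theorem card_nonroot (n : ℕ) (d : Fin n → ℕ) (hd : ∀ i, 1 ≤ d i) :
    (Finset.univ.filter fun h : HE d => IsNonRootHE d h).card = (∑ i, d i) - n := by
  have h1 : (Finset.univ.filter fun h : HE d => IsNonRootHE d h) =
      Finset.univ.sigma (fun i => Finset.univ.filter fun j : Fin (d i) => (j : ℕ) < d i - 1) := by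
    ext ⟨i, j⟩
    simp only [Finset.mem_filter, Finset.mem_sigma, Finset.mem_univ, true_and]
    rfl
  rw [h1, Finset.card_sigma]
  have h2 : ∀ i, (Finset.univ.filter fun j : Fin (d i) => (j : ℕ) < d i - 1).card = d i - 1 := by
    intro i
    rw [Fin.card_filter_val_lt]
    omega
  simp only [h2]
  rw [Finset.sum_tsub_distrib _ (fun i _ => hd i)]
  simp

/-- The sequence `(s_1, …, s_{n-1})` of non-root half-edges chosen by Pitman's additive
coalescent is uniform over all sequences of `n-1` distinct elements of the set of
non-root half-edges (a set of size `2m - n` where `2m = ∑ i, d i`, so there are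
`(2m - n)_{n-1}` such sequences); consequently the unordered set `{s_1, …, s_{n-1}}`
is a uniformly random `(n-1)`-element subset of the non-root half-edges. -/
theorem nonroot_halfedges_uniform (n : ℕ) (hn : 1 ≤ n) (d : Fin n → ℕ)
    (hd : ∀ i, 1 ≤ d i) (hsum : 2 * n - 1 ≤ ∑ i, d i) :
    (∀ σ : Fin (n - 1) → HE d, Function.Injective σ → (∀ k, IsNonRootHE d (σ k)) →
      (Nat.card {E : Path d // IsExecPath d E ∧ ∀ k, (E k).2 = σ k} : ℝ)
          / (Nat.card {E : Path d // IsExecPath d E} : ℝ)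
        = 1 / (Nat.descFactorial ((∑ i, d i) - n) (n - 1) : ℝ))
    ∧ (∀ H : Finset (HE d), (∀ h ∈ H, IsNonRootHE d h) → H.card = n - 1 →
      (Nat.card {E : Path d // IsExecPath d E ∧ SSetEq E H} : ℝ)
          / (Nat.card {E : Path d // IsExecPath d E} : ℝ)
        = 1 / (Nat.choose ((∑ i, d i) - n) (n - 1) : ℝ)) := by
  have htot : Nat.card {E : Path d // IsExecPath d E} =
      ((∑ i, d i) - n).descFactorial (n - 1) * (n - 1).factorial := by
    rw [← card_nonroot n d hd, ← card_in n hn d hd _ (fun h hh => (Finset.mem_filter.1 hh).2)]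
    refine Nat.card_congr (Equiv.subtypeEquivRight fun E => ?_)
    constructor
    · intro h
      exact ⟨h, fun k => Finset.mem_filter.2 ⟨Finset.mem_univ _, (h k).2.1⟩⟩
    · exact fun h => h.1
  have hle : n - 1 ≤ (∑ i, d i) - n := by omega
  have hpos : ((((∑ i, d i) - n).descFactorial (n - 1) : ℕ) : ℝ) ≠ 0 := by
    rw [Nat.cast_ne_zero, Ne, Nat.descFactorial_eq_zero_iff_lt]
    omega
  have hfac : (((n - 1).factorial : ℕ) : ℝ) ≠ 0 := by
    exact_mod_cast Nat.factorial_ne_zero _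
  refine ⟨?_, ?_⟩
  · intro σ h1 h2
    rw [card_seq n hn d hd σ h1 h2, htot]
    push_cast
    field_simp
  · intro H hH hc
    have h1 : Nat.card {E : Path d // IsExecPath d E ∧ SSetEq E H} =
        (n - 1).factorial * (n - 1).factorial := by
      have := card_in n hn d hd H hH
      rw [hc, Nat.descFactorial_self] at this
      rw [← this]
      refine Nat.card_congr (Equiv.subtypeEquivRight fun E => and_congr_right fun hE => ?_)
      constructor
      · intro h k
        exact (h _).2 ⟨k, rfl⟩
      · intro h
        have hi : Finset.univ.image (fun k => (E k).2) = H := by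
          apply Finset.eq_of_subset_of_card_le
          · intro x hx
            obtain ⟨k, _, rfl⟩ := Finset.mem_image.1 hx
            exact h k
          · rw [Finset.card_image_of_injective _ (exec_inj hE), hc]
            simp
        intro x
        rw [← hi]
        simp
    have h2 := Nat.descFactorial_eq_factorial_mul_choose ((∑ i, d i) - n) (n - 1)
    rw [h1, htot, h2]
    rw [h2] at hpos
    push_cast at hpos ⊢
    have := right_ne_zero_of_mul hpos
    field_simp

end TWG
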